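/- arXiv:2408.03577 — 2 statements merged into one kernel-verified Lean document; each statement's English description precedes it below -/
import Mathlib

section
/- With the compact parameter space P and the notation below: the pointwise limit G_{γ(ω)}⁺(z) = lim_{n→∞} G_{γ(ω),n}⁺(z) exists for every (z, ω) ∈ ℂ² × P^ℤ, and the function (z, ω) ↦ G_{γ(ω)}⁺(z) is continuous on ℂ² × P^ℤ (with the product topology on P^ℤ). The analogous statement holds for the functions G_{γ(ω),n}⁻(z) = (deg γ(ω)_{−1} ⋯ deg γ(ω)_{−n})⁻¹ · log⁺‖γ(ω)_{−n}⁻¹∘⋯∘γ(ω)_{−1}⁻¹(z)‖ and their limit G_{γ(ω)}⁻. -/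
open Complex Filter Set Topology MeasureTheory Bornology

noncomputable section

/-- The parameter space `∐_{n ∈ N} (ℂ × ℂ × ℂ^{n+1})`: a parameter `(a, δ, c)` with the
degree `n` recorded in the sigma-index. (The constraints `δ ≠ 0`, `c₀ ≠ 0` defining `Ω_n`
are imposed separately.) -/
abbrev Param (N : Finset ℕ) : Type :=
  Σ n : {m : ℕ // m ∈ N}, ℂ × ℂ × (Fin (n.1 + 1) → ℂ)

/-- Evaluation of the polynomial `p(y) = c₀ yⁿ + c₁ y^{n-1} + ⋯ + c_n`. -/
def pEval (n : ℕ) (c : Fin (n + 1) → ℂ) (y : ℂ) : ℂ :=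
  ∑ i : Fin (n + 1), c i * y ^ (n - (i : ℕ))

/-- The Hénon-form map `f_q(x,y) = (y + a, p(y) - δ x)` attached to a parameter `q`. -/
def fq {N : Finset ℕ} (q : Param N) (z : ℂ × ℂ) : ℂ × ℂ :=
  (z.2 + q.2.1, pEval q.1.1 q.2.2.2 z.2 - q.2.2.1 * z.1)

/-- The inverse map `f_q⁻¹(x,y) = (δ⁻¹ (p(x - a) - y), x - a)`. -/
def fqInv {N : Finset ℕ} (q : Param N) (z : ℂ × ℂ) : ℂ × ℂ :=
  (q.2.2.1⁻¹ * (pEval q.1.1 q.2.2.2 (z.1 - q.2.1) - z.2), z.1 - q.2.1)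

/-- `log⁺ t = max (log t) 0`. -/
def logPlus (t : ℝ) : ℝ := max (Real.log t) 0

/-- Forward composition `γ(ω)_{n-1} ∘ ⋯ ∘ γ(ω)₀` of the maps attached to a sequence
`ω ∈ P^ℤ`. -/
def fwdP {N : Finset ℕ} {P : Set (Param N)} (ω : ℤ → ↥P) : ℕ → (ℂ × ℂ) → ℂ × ℂ
  | 0 => id
  | n + 1 => fun z => fq ((ω (n : ℤ)) : Param N) (fwdP ω n z)

/-- Backward composition `γ(ω)_{-n}⁻¹ ∘ ⋯ ∘ γ(ω)_{-1}⁻¹`. -/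
def bwdP {N : Finset ℕ} {P : Set (Param N)} (ω : ℤ → ↥P) : ℕ → (ℂ × ℂ) → ℂ × ℂ
  | 0 => id
  | n + 1 => fun z => fqInv ((ω (-((n : ℤ) + 1))) : Param N) (bwdP ω n z)

/-- `G_{γ(ω),n}⁺(z) = (deg γ(ω)_{n-1} ⋯ deg γ(ω)₀)⁻¹ log⁺ ‖fwdP ω n z‖`. -/
def GPn {N : Finset ℕ} {P : Set (Param N)} (ω : ℤ → ↥P) (n : ℕ) (z : ℂ × ℂ) : ℝ :=
  (∏ j ∈ Finset.range n, (((ω (j : ℤ)).1.1.1 : ℕ) : ℝ))⁻¹ * logPlus ‖fwdP ω n z‖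

/-- `G_{γ(ω),n}⁻(z) = (deg γ(ω)_{-1} ⋯ deg γ(ω)_{-n})⁻¹ log⁺ ‖bwdP ω n z‖`. -/
def GMn {N : Finset ℕ} {P : Set (Param N)} (ω : ℤ → ↥P) (n : ℕ) (z : ℂ × ℂ) : ℝ :=
  (∏ j ∈ Finset.range n, (((ω (-((j : ℤ) + 1))).1.1.1 : ℕ) : ℝ))⁻¹ * logPlus ‖bwdP ω n z‖

/-- `K_{γ(ω)}⁺` : points with bounded forward orbit. -/
def KPlusP {N : Finset ℕ} {P : Set (Param N)} (ω : ℤ → ↥P) : Set (ℂ × ℂ) :=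
  {z | IsBounded (Set.range fun n : ℕ => fwdP ω n z)}

/-- `K_{γ(ω)}⁻` : points with bounded backward orbit. -/
def KMinusP {N : Finset ℕ} {P : Set (Param N)} (ω : ℤ → ↥P) : Set (ℂ × ℂ) :=
  {z | IsBounded (Set.range fun n : ℕ => bwdP ω n z)}

/-- truncated norm -/
def MR (R : ℝ) (z : ℂ × ℂ) : ℝ := max ‖z‖ R

/-- the forward filtration region -/
def VR (R : ℝ) (z : ℂ × ℂ) : Prop := ‖z.1‖ ≤ ‖z.2‖ ∧ R ≤ ‖z.2‖

lemma logPlus_le_logMR {R : ℝ} (hR : 1 ≤ R) (z : ℂ × ℂ) :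
    logPlus ‖z‖ ≤ Real.log (MR R z) := by
  unfold logPlus MR
  have h1 : 0 ≤ Real.log (max ‖z‖ R) := Real.log_nonneg (hR.trans (le_max_right _ _))
  refine max_le ?_ h1
  rcases (norm_nonneg z).eq_or_lt with h | h
  · rw [← h] at h1 ⊢
    simpa using h1
  · exact Real.log_le_log h (le_max_left _ _)

lemma logMR_le {R : ℝ} (hR : 1 ≤ R) (z : ℂ × ℂ) :
    Real.log (MR R z) ≤ logPlus ‖z‖ + Real.log R := by
  unfold logPlus MR
  have h2 : 0 ≤ Real.log R := Real.log_nonneg hR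
  rcases le_total ‖z‖ R with h | h
  · rw [max_eq_right h]
    linarith [le_max_right (Real.log ‖z‖) 0]
  · rw [max_eq_left h]
    linarith [le_max_left (Real.log ‖z‖) 0]

lemma henon_geo (d : ℕ) (hd : 2 ≤ d) (a δ : ℂ) (g : ℂ → ℂ) (A Δ K k R0 R : ℝ)
    (hk : 0 < k) (hK : 0 ≤ K) (ha : ‖a‖ ≤ A) (hδ : ‖δ‖ ≤ Δ)
    (hg1 : ∀ y, ‖g y‖ ≤ K * (max ‖y‖ 1) ^ d)
    (hg2 : ∀ y, R0 ≤ ‖y‖ → k * ‖y‖ ^ d ≤ ‖g y‖)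
    (hR1 : 1 ≤ R) (hR0 : R0 ≤ R) (hRΔ : 2 * Δ ≤ k * R) (hRA : 2 * (1 + A) ≤ k * R)
    (z w : ℂ × ℂ) (hw : w = (z.2 + a, g z.2 - δ * z.1)) :
    ‖w.1‖ ≤ ‖z.2‖ + A ∧
    Real.log (MR R w) ≤ d * Real.log (MR R z) +
      (Real.log (1 + A + K + Δ + R) + |Real.log (k / 2)|) ∧
    (VR R z → VR R w ∧ d * Real.log (MR R z) ≤ Real.log (MR R w) +
      (Real.log (1 + A + K + Δ + R) + |Real.log (k / 2)|)) := by
  have hA0 : 0 ≤ A := (norm_nonneg _).trans ha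
  have hΔ0 : 0 ≤ Δ := (norm_nonneg _).trans hδ
  have hw1 : ‖w.1‖ ≤ ‖z.2‖ + A := by
    rw [hw]
    exact (norm_add_le _ _).trans (by gcongr)
  have hL0 : 0 ≤ Real.log (1 + A + K + Δ + R) := Real.log_nonneg (by linarith)
  have hd0 : d ≠ 0 := by omega
  refine ⟨hw1, ?_, ?_⟩
  · set m := MR R z with hm
    have hmR : R ≤ m := le_max_right _ _
    have hm1 : 1 ≤ m := hR1.trans hmR
    have hzm : ‖z‖ ≤ m := le_max_left _ _
    have hz1 : ‖z.1‖ ≤ m := (norm_fst_le z).trans hzm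
    have hz2 : ‖z.2‖ ≤ m := (norm_snd_le z).trans hzm
    have hmd : m ≤ m ^ d := le_self_pow₀ hm1 hd0
    have h1d : 1 ≤ m ^ d := hm1.trans hmd
    have key : MR R w ≤ (1 + A + K + Δ + R) * m ^ d := by
      unfold MR
      rw [Prod.norm_def]
      have e : (1 + A + K + Δ + R) * m ^ d
        = m ^ d + A * m ^ d + K * m ^ d + Δ * m ^ d + R * m ^ d := by ring
      have p1 : 0 ≤ A * m ^ d := by positivity
      have p2 : 0 ≤ K * m ^ d := by positivity
      have p3 : 0 ≤ Δ * m ^ d := by positivity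
      have p4 : A ≤ A * m ^ d := le_mul_of_one_le_right hA0 h1d
      have p5 : R ≤ R * m ^ d := le_mul_of_one_le_right (by linarith) h1d
      refine max_le (max_le ?_ ?_) ?_
      · linarith
      · have q1 : ‖w.2‖ ≤ K * m ^ d + Δ * m := by
          rw [hw]
          refine (norm_sub_le _ _).trans (add_le_add ?_ ?_)
          · refine (hg1 _).trans ?_
            have : max ‖z.2‖ 1 ≤ m := max_le hz2 hm1
            gcongr
          · rw [norm_mul]
            gcongr
        have q2 : Δ * m ≤ Δ * m ^ d := by gcongr
        linarith
      · linarith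
    have hpos : 0 < MR R w := lt_of_lt_of_le (by linarith) (le_max_right _ _)
    have := Real.log_le_log hpos key
    rw [Real.log_mul (by positivity) (by positivity), Real.log_pow] at this
    linarith [abs_nonneg (Real.log (k / 2))]
  · rintro ⟨v1, v2⟩
    set t := ‖z.2‖ with ht
    have ht1 : 1 ≤ t := hR1.trans v2
    have hM : MR R z = t := by
      unfold MR
      rw [Prod.norm_def, max_eq_right v1, max_eq_left v2]
    have hg := hg2 z.2 (hR0.trans v2)
    have hkt : k * R ≤ k * t := by gcongr
    have htd : t ^ 2 ≤ t ^ d := pow_le_pow_right₀ ht1 hd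
    have hktd : k * t ^ 2 ≤ k * t ^ d := by gcongr
    have hbig : k / 2 * t ^ d ≤ ‖w.2‖ := by
      have : ‖g z.2‖ - ‖δ * z.1‖ ≤ ‖w.2‖ := by
        rw [hw]
        exact norm_sub_norm_le _ _
      have h2 : ‖δ * z.1‖ ≤ Δ * t := by
        rw [norm_mul]
        gcongr
      have h3 : Δ * t ≤ k / 2 * t ^ 2 := by nlinarith
      nlinarith
    have hb2 : t + A ≤ k / 2 * t ^ d := by nlinarith
    have hV : VR R w := by
      constructor <;> linarith
    refine ⟨hV, ?_⟩
    have hMw : MR R w = ‖w.2‖ := by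
      unfold MR
      rw [Prod.norm_def, max_eq_right hV.1, max_eq_left hV.2]
    rw [hM, hMw]
    have := Real.log_le_log (by positivity) hbig
    rw [Real.log_mul (by positivity) (by positivity), Real.log_pow] at this
    linarith [neg_abs_le (Real.log (k / 2))]

lemma core_step {Q : Type*} (d : Q → ℕ) (hd : ∀ q, 2 ≤ d q)
    (F : Q → ℂ × ℂ → ℂ × ℂ) (R A C : ℝ) (hR : 1 ≤ R) (hA : 0 ≤ A) (hC : 0 ≤ C)
    (h1 : ∀ q z, ‖(F q z).1‖ ≤ ‖z.2‖ + A)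
    (h2 : ∀ q z, Real.log (MR R (F q z)) ≤ d q * Real.log (MR R z) + C)
    (h3 : ∀ q z, VR R z → VR R (F q z) ∧
      d q * Real.log (MR R z) ≤ Real.log (MR R (F q z)) + C)
    (s : ℕ → Q) (o : ℕ → ℂ × ℂ) (ho : ∀ n, o (n + 1) = F (s n) (o n)) (n : ℕ) :
    |(∏ j ∈ Finset.range (n + 1), (d (s j) : ℝ))⁻¹ * Real.log (MR R (o (n + 1))) -
      (∏ j ∈ Finset.range n, (d (s j) : ℝ))⁻¹ * Real.log (MR R (o n))|
      ≤ (C + (MR R (o 0) + n * A)) * (1 / 2) ^ n := by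
  have hgrow : ∀ n, ¬ VR R (o n) → MR R (o n) ≤ MR R (o 0) + n * A := by
    intro n
    induction n with
    | zero => intro _; simp
    | succ n ih =>
      intro hn
      have hn' : ¬ VR R (o n) := by
        intro h
        apply hn
        rw [ho]
        exact (h3 _ _ h).1
      have h := ih hn'
      have e1 := h1 (s n) (o n)
      rw [← ho] at e1
      have e2 : ‖(o n).2‖ ≤ MR R (o n) := (norm_snd_le _).trans (le_max_left _ _)
      have e3 : R ≤ MR R (o n) := le_max_right _ _
      push_cast
      have e4 : MR R (o (n + 1)) ≤ MR R (o n) + A := by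
        unfold MR at *
        rw [Prod.norm_def (o (n+1))]
        refine max_le (max_le (by linarith) ?_) (by linarith)
        by_contra hcon
        push Not at hcon
        exact hn ⟨by linarith, by linarith⟩
      linarith
  have hMpos : ∀ z, 1 ≤ MR R z := fun z => hR.trans (le_max_right _ _)
  have hlog0 : ∀ z, 0 ≤ Real.log (MR R z) := fun z => Real.log_nonneg (hMpos z)
  rw [Finset.prod_range_succ]
  set D := ∏ j ∈ Finset.range n, (d (s j) : ℝ) with hD
  have hDge : (2 : ℝ) ^ n ≤ D := by
    have : ∏ j ∈ Finset.range n, (2 : ℝ) ≤ D :=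
      Finset.prod_le_prod (fun _ _ => by norm_num) (fun j _ => by exact_mod_cast hd (s j))
    simpa using this
  have hDpos : 0 < D := lt_of_lt_of_le (by positivity) hDge
  have hDinv : D⁻¹ ≤ (1 / 2) ^ n := by
    rw [one_div, inv_pow]
    exact inv_anti₀ (by positivity) hDge
  have hd2 : (2 : ℝ) ≤ d (s n) := by exact_mod_cast hd (s n)
  set e : ℝ := (d (s n) : ℝ) with he
  have hepos : 0 < e := by linarith
  set u := Real.log (MR R (o n)) with hu
  set v := Real.log (MR R (o (n + 1))) with hv
  have hu0 : 0 ≤ u := hlog0 _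
  have hv0 : 0 ≤ v := hlog0 _
  have hup : v ≤ e * u + C := by
    rw [hv, ho]
    exact h2 _ _
  have hX : 0 ≤ MR R (o 0) + n * A := by
    have := hMpos (o 0)
    positivity
  have hlow : e * u ≤ v + C + e * (MR R (o 0) + n * A) := by
    by_cases hV : VR R (o n)
    · have := (h3 (s n) (o n) hV).2
      rw [← ho] at this
      have h0 : 0 ≤ e * (MR R (o 0) + n * A) := by positivity
      linarith
    · have := hgrow n hV
      have h4 : u ≤ MR R (o n) := (Real.log_le_sub_one_of_pos (by linarith [hMpos (o n)])).trans
        (by linarith)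
      have h5 : e * u ≤ e * (MR R (o 0) + n * A) := by
        gcongr
        linarith
      linarith
  have hdiff : |v / e - u| ≤ C + (MR R (o 0) + n * A) := by
    have hve : v = e * (v / e) := by field_simp
    have hC' : C ≤ e * C := by nlinarith
    rw [hve] at hup hlow
    rw [abs_le]
    constructor
    · by_contra hcon
      push Not at hcon
      nlinarith
    · by_contra hcon
      push Not at hcon
      nlinarith [mul_nonneg hepos.le hX]
  have : (D * e)⁻¹ * v - D⁻¹ * u = (v / e - u) * D⁻¹ := by
    field_simp
  rw [this, abs_mul, abs_of_pos (inv_pos.mpr hDpos)]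
  gcongr

lemma core {Q Ω : Type*} [TopologicalSpace Q] [TopologicalSpace Ω]
    (d : Q → ℕ) (hd : ∀ q, 2 ≤ d q) (hdc : Continuous fun q => (d q : ℝ))
    (F : Q → ℂ × ℂ → ℂ × ℂ) (hF : Continuous fun x : Q × (ℂ × ℂ) => F x.1 x.2)
    (R A C : ℝ) (hR : 1 ≤ R) (hA : 0 ≤ A) (hC : 0 ≤ C)
    (h1 : ∀ q z, ‖(F q z).1‖ ≤ ‖z.2‖ + A)
    (h2 : ∀ q z, Real.log (MR R (F q z)) ≤ d q * Real.log (MR R z) + C)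
    (h3 : ∀ q z, VR R z → VR R (F q z) ∧
      d q * Real.log (MR R z) ≤ Real.log (MR R (F q z)) + C)
    (s : ℕ → Ω → Q) (hs : ∀ n, Continuous (s n))
    (o : ℕ → Ω → ℂ × ℂ → ℂ × ℂ) (ho0 : ∀ ω z, o 0 ω z = z)
    (ho : ∀ n ω z, o (n + 1) ω z = F (s n ω) (o n ω z)) :
    ∃ G : (ℂ × ℂ) → Ω → ℝ,
      (∀ z ω, Filter.Tendsto (fun n : ℕ =>
        (∏ j ∈ Finset.range n, (d (s j ω) : ℝ))⁻¹ * logPlus ‖o n ω z‖)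
          Filter.atTop (nhds (G z ω))) ∧
      Continuous (fun x : (ℂ × ℂ) × Ω => G x.1 x.2) := by
  have hDge : ∀ n ω, (2 : ℝ) ^ n ≤ ∏ j ∈ Finset.range n, (d (s j ω) : ℝ) := by
    intro n ω
    have : ∏ j ∈ Finset.range n, (2 : ℝ) ≤ ∏ j ∈ Finset.range n, (d (s j ω) : ℝ) :=
      Finset.prod_le_prod (fun _ _ => by norm_num) (fun j _ => by exact_mod_cast hd (s j ω))
    simpa using this
  have hDpos : ∀ n ω, 0 < ∏ j ∈ Finset.range n, (d (s j ω) : ℝ) := fun n ω =>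
    lt_of_lt_of_le (by positivity) (hDge n ω)
  have hoc : ∀ n, Continuous fun x : (ℂ × ℂ) × Ω => o n x.2 x.1 := by
    intro n
    induction n with
    | zero => simpa only [ho0] using (continuous_fst : Continuous fun x : (ℂ × ℂ) × Ω => x.1)
    | succ n ih =>
      simp only [ho]
      exact hF.comp (((hs n).comp continuous_snd).prodMk ih)
  let u : ℕ → (ℂ × ℂ) × Ω → ℝ := fun n x =>
    (∏ j ∈ Finset.range n, (d (s j x.2) : ℝ))⁻¹ * Real.log (MR R (o n x.2 x.1))
  have huc : ∀ n, Continuous (u n) := by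
    intro n
    refine Continuous.mul (Continuous.inv₀ ?_ fun x => (hDpos n x.2).ne') ?_
    · exact continuous_finsetProd _ fun j _ => hdc.comp ((hs j).comp continuous_snd)
    · refine Continuous.log ((hoc n).norm.max continuous_const) fun x => ?_
      have : R ≤ max ‖o n x.2 x.1‖ R := le_max_right _ _
      exact (by linarith : (0 : ℝ) < max ‖o n x.2 x.1‖ R).ne'
  have hub : ∀ n x, |u (n + 1) x - u n x| ≤ (C + (MR R x.1 + n * A)) * (1 / 2) ^ n := by
    intro n x
    have := core_step d hd F R A C hR hA hC h1 h2 h3 (fun n => s n x.2) (fun n => o n x.2 x.1)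
      (fun n => ho n x.2 x.1) n
    simpa only [ho0] using this
  have hsum : ∀ B : ℝ, Summable fun n : ℕ => (C + (B + n * A)) * (1 / 2 : ℝ) ^ n := by
    intro B
    have e1 : Summable fun n : ℕ => (1 / 2 : ℝ) ^ n := summable_geometric_two
    have e2 : Summable fun n : ℕ => (n : ℝ) ^ 1 * (1 / 2 : ℝ) ^ n :=
      summable_pow_mul_geometric_of_norm_lt_one 1 (by norm_num)
    refine ((e1.mul_left (C + B)).add (e2.mul_left A)).congr fun n => ?_
    ring
  let G : (ℂ × ℂ) × Ω → ℝ := fun x => u 0 x + ∑' n, (u (n + 1) x - u n x)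
  have hsx : ∀ x, Summable fun n => u (n + 1) x - u n x := fun x =>
    Summable.of_norm_bounded (hsum (MR R x.1)) fun n => hub n x
  have hGu : ∀ x, Tendsto (fun n => u n x) atTop (𝓝 (G x)) := by
    intro x
    have := ((hsx x).hasSum.tendsto_sum_nat).const_add (u 0 x)
    refine this.congr fun n => ?_
    rw [Finset.sum_range_sub (fun n => u n x)]
    ring
  refine ⟨fun z ω => G (z, ω), ?_, ?_⟩
  · intro z ω
    have hsmall : Tendsto (fun n : ℕ => u n (z, ω) -
        (∏ j ∈ Finset.range n, (d (s j ω) : ℝ))⁻¹ * logPlus ‖o n ω z‖) atTop (𝓝 0) := by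
      have hg : Tendsto (fun n : ℕ => (1 / 2 : ℝ) ^ n * Real.log R) atTop (𝓝 0) := by
        have := (tendsto_pow_atTop_nhds_zero_of_lt_one (r := (1 / 2 : ℝ))
          (by norm_num) (by norm_num)).mul_const (Real.log R)
        simpa using this
      refine squeeze_zero (fun n => ?_) (fun n => ?_) hg
      · have := logPlus_le_logMR hR (o n ω z)
        have h0 := (inv_pos.mpr (hDpos n ω)).le
        simp only [u]
        rw [← mul_sub]
        exact mul_nonneg h0 (by linarith)
      · have := logMR_le hR (o n ω z)
        have h0 := (inv_pos.mpr (hDpos n ω)).le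
        simp only [u]
        rw [← mul_sub]
        have hDinv : (∏ j ∈ Finset.range n, (d (s j ω) : ℝ))⁻¹ ≤ (1 / 2) ^ n := by
          rw [one_div, inv_pow]
          exact inv_anti₀ (by positivity) (hDge n ω)
        have hl := Real.log_nonneg hR
        refine (mul_le_mul_of_nonneg_left (by linarith : _ ≤ Real.log R) h0).trans ?_
        gcongr
    have := (hGu (z, ω)).sub hsmall
    simpa using this
  · change Continuous G
    rw [continuous_iff_continuousAt]
    intro x
    let U : Set ((ℂ × ℂ) × Ω) := {y | MR R y.1 < MR R x.1 + 1}
    have hU : IsOpen U := by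
      refine isOpen_lt ?_ continuous_const
      exact continuous_fst.norm.max continuous_const
    have hxU : x ∈ U := by simp [U]
    have hcont : ContinuousOn G U := by
      refine (huc 0).continuousOn.add ?_
      refine continuousOn_tsum (fun n => ((huc (n + 1)).sub (huc n)).continuousOn)
        (hsum (MR R x.1 + 1)) fun n y hy => ?_
      refine (hub n y).trans ?_
      have : MR R y.1 ≤ MR R x.1 + 1 := le_of_lt hy
      gcongr
    exact hcont.continuousAt (hU.mem_nhds hxU)

lemma pEval_upper (n : ℕ) (c : Fin (n + 1) → ℂ) (y : ℂ) :
    ‖pEval n c y‖ ≤ (∑ i, ‖c i‖) * (max ‖y‖ 1) ^ n := by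
  unfold pEval
  rw [Finset.sum_mul]
  refine (norm_sum_le _ _).trans (Finset.sum_le_sum fun i _ => ?_)
  rw [norm_mul, norm_pow]
  gcongr
  calc ‖y‖ ^ (n - (i : ℕ)) ≤ (max ‖y‖ 1) ^ (n - (i : ℕ)) := by
        gcongr
        exact le_max_left _ _
    _ ≤ (max ‖y‖ 1) ^ n := pow_le_pow_right₀ (le_max_right _ _) (Nat.sub_le _ _)

lemma pEval_lower (n : ℕ) (hn : 2 ≤ n) (c : Fin (n + 1) → ℂ) (y : ℂ) (k S : ℝ)
    (hk : 0 < k) (hc : k ≤ ‖c 0‖) (hS : ∑ i, ‖c i‖ ≤ S) (hy : 1 ≤ ‖y‖) (hy2 : 2 * S / k ≤ ‖y‖) :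
    k / 2 * ‖y‖ ^ n ≤ ‖pEval n c y‖ := by
  obtain ⟨m, rfl⟩ : ∃ m, n = m + 1 := ⟨n - 1, by omega⟩
  unfold pEval
  rw [Fin.sum_univ_succ] at hS ⊢
  have h1 : ‖∑ i : Fin (m + 1), c i.succ * y ^ (m + 1 - (i.succ : ℕ))‖ ≤ S * ‖y‖ ^ m := by
    refine (norm_sum_le _ _).trans ?_
    have : ∑ i : Fin (m + 1), ‖c i.succ‖ ≤ S := by linarith [norm_nonneg (c 0)]
    refine le_trans ?_ (mul_le_mul_of_nonneg_right this (by positivity))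
    rw [Finset.sum_mul]
    refine Finset.sum_le_sum fun i _ => ?_
    rw [norm_mul, norm_pow]
    gcongr
    simp
  have h2 := norm_sub_le_norm_add (c 0 * y ^ (m + 1 - ((0 : Fin (m + 2)) : ℕ)))
    (∑ i : Fin (m + 1), c i.succ * y ^ (m + 1 - (i.succ : ℕ)))
  have h3 : k * ‖y‖ ^ (m + 1) ≤ ‖c 0 * y ^ (m + 1 - ((0 : Fin (m + 2)) : ℕ))‖ := by
    rw [norm_mul, norm_pow]
    simp only [Fin.val_zero, Nat.sub_zero]
    gcongr
  rw [div_le_iff₀ hk] at hy2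
  have h4 : S * ‖y‖ ^ m ≤ k / 2 * ‖y‖ ^ (m + 1) := by
    rw [pow_succ]
    have : 0 ≤ ‖y‖ ^ m := by positivity
    nlinarith
  linarith

lemma continuous_pEval (n : ℕ) : Continuous fun x : (Fin (n + 1) → ℂ) × ℂ => pEval n x.1 x.2 := by
  unfold pEval
  fun_prop

lemma continuous_param_sub {N : Finset ℕ} {P : Set (Param N)} {X : Type*} [TopologicalSpace X]
    {Y : Type*} [TopologicalSpace Y]
    (F : Param N → X → Y)
    (hF : ∀ n : {m : ℕ // m ∈ N},
      ContinuousOn (fun x : (ℂ × ℂ × (Fin (n.1 + 1) → ℂ)) × X => F ⟨n, x.1⟩ x.2)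
        {x | (⟨n, x.1⟩ : Param N) ∈ P}) :
    Continuous fun x : ↥P × X => F x.1.1 x.2 := by
  have key : ContinuousOn (fun x : Param N × X => F x.1 x.2) {x | x.1 ∈ P} := by
    rintro ⟨⟨n, q⟩, z⟩ hx
    have hoe : IsOpenEmbedding
        (fun x : (ℂ × ℂ × (Fin (n.1 + 1) → ℂ)) × X => ((⟨n, x.1⟩ : Param N), x.2)) :=
      (IsOpenEmbedding.sigmaMk (σ := fun n : {m : ℕ // m ∈ N} =>
        ℂ × ℂ × (Fin (n.1 + 1) → ℂ)) (i := n)).prodMap IsOpenEmbedding.id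
    have h := hF n (q, z) hx
    unfold ContinuousWithinAt at h ⊢
    have e : 𝓝[{x : Param N × X | x.1 ∈ P}] ((⟨n, q⟩ : Param N), z)
        = Filter.map (fun x : (ℂ × ℂ × (Fin (n.1 + 1) → ℂ)) × X => ((⟨n, x.1⟩ : Param N), x.2))
          (𝓝[{x | (⟨n, x.1⟩ : Param N) ∈ P}] (q, z)) := by
      exact (hoe.map_nhdsWithin_preimage_eq {x : Param N × X | x.1 ∈ P} (q, z)).symm
    rw [e, Filter.tendsto_map'_iff]
    exact h
  exact key.comp_continuous (continuous_subtype_val.prodMap continuous_id) fun x => x.1.2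

lemma param_bound {N : Finset ℕ} {P : Set (Param N)} (hPc : IsCompact P)
    (F : Param N → ℝ)
    (hF : ∀ n : {m : ℕ // m ∈ N},
      ContinuousOn (fun x : (ℂ × ℂ × (Fin (n.1 + 1) → ℂ)) => F ⟨n, x⟩)
        {x | (⟨n, x⟩ : Param N) ∈ P}) : ∃ B : ℝ, 1 ≤ B ∧ ∀ q ∈ P, F q ≤ B := by
  have h := continuous_param_sub (P := P) (X := Unit) (fun q _ => F q) (by
    intro n
    exact (hF n).comp continuous_fst.continuousOn fun x hx => hx)
  have h' : Continuous fun q : ↥P => F q.1 := h.comp (continuous_id.prodMk (continuous_const (y := ())))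
  have := isCompact_iff_compactSpace.mp hPc
  obtain ⟨B, hB⟩ := (isCompact_range h').bddAbove
  exact ⟨max B 1, le_max_right _ _, fun q hq =>
    (hB ⟨⟨q, hq⟩, rfl⟩).trans (le_max_left _ _)⟩


lemma henon_core {Q Ω : Type*} [TopologicalSpace Q] [TopologicalSpace Ω]
    (d : Q → ℕ) (hd : ∀ q, 2 ≤ d q) (hdc : Continuous fun q => (d q : ℝ))
    (F : Q → ℂ × ℂ → ℂ × ℂ) (hF : Continuous fun x : Q × (ℂ × ℂ) => F x.1 x.2)
    (a δ : Q → ℂ) (g : Q → ℂ → ℂ)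
    (hFe : ∀ q z, F q z = (z.2 + a q, g q z.2 - δ q * z.1))
    (A Δ K k R0 : ℝ) (hk : 0 < k) (hK : 0 ≤ K) (hA : 0 ≤ A) (hΔ : 0 ≤ Δ) (hR0 : 1 ≤ R0)
    (ha : ∀ q, ‖a q‖ ≤ A) (hδ : ∀ q, ‖δ q‖ ≤ Δ)
    (hg1 : ∀ q y, ‖g q y‖ ≤ K * (max ‖y‖ 1) ^ d q)
    (hg2 : ∀ q y, R0 ≤ ‖y‖ → k * ‖y‖ ^ d q ≤ ‖g q y‖)
    (s : ℕ → Ω → Q) (hs : ∀ n, Continuous (s n))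
    (o : ℕ → Ω → ℂ × ℂ → ℂ × ℂ) (ho0 : ∀ ω z, o 0 ω z = z)
    (ho : ∀ n ω z, o (n + 1) ω z = F (s n ω) (o n ω z)) :
    ∃ G : (ℂ × ℂ) → Ω → ℝ,
      (∀ z ω, Filter.Tendsto (fun n : ℕ =>
        (∏ j ∈ Finset.range n, (d (s j ω) : ℝ))⁻¹ * logPlus ‖o n ω z‖)
          Filter.atTop (nhds (G z ω))) ∧
      Continuous (fun x : (ℂ × ℂ) × Ω => G x.1 x.2) := by
  obtain ⟨R, hR⟩ : ∃ R, R = R0 + 2 * Δ / k + 2 * (1 + A) / k := ⟨_, rfl⟩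
  have p1 : 0 ≤ 2 * Δ / k := by positivity
  have p2 : 0 ≤ 2 * (1 + A) / k := by positivity
  have hkR : k * R = k * R0 + 2 * Δ + 2 * (1 + A) := by
    rw [hR]
    field_simp
  have hkR0 : 0 ≤ k * R0 := by positivity
  have geo := fun q z => henon_geo (d q) (hd q) (a q) (δ q) (g q) A Δ K k R0 R hk hK (ha q) (hδ q)
    (hg1 q) (hg2 q) (by linarith) (by linarith) (by linarith) (by linarith) z (F q z) (hFe q z)
  have hC : 0 ≤ Real.log (1 + A + K + Δ + R) + |Real.log (k / 2)| :=
    add_nonneg (Real.log_nonneg (by linarith)) (abs_nonneg _)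
  exact core d hd hdc F hF R A _ (by linarith) hA hC (fun q z => (geo q z).1)
    (fun q z => (geo q z).2.1) (fun q z => (geo q z).2.2) s hs o ho0 ho

/-- existence of the pointwise limits `G_{γ(ω)}±` of `G_{γ(ω),n}±` and
joint continuity of `(z, ω) ↦ G_{γ(ω)}±(z)` on `ℂ² × P^ℤ`. -/
theorem stmt_14 (N : Finset ℕ) (hN : ∀ n ∈ N, 2 ≤ n)
    (P : Set (Param N)) (hPne : P.Nonempty) (hPc : IsCompact P)
    (hP : ∀ q ∈ P, q.2.2.1 ≠ 0 ∧ q.2.2.2 0 ≠ 0) :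
    ∃ Gp Gm : (ℂ × ℂ) → (ℤ → ↥P) → ℝ,
      (∀ (z : ℂ × ℂ) (ω : ℤ → ↥P),
        Filter.Tendsto (fun n : ℕ => GPn ω n z) Filter.atTop (nhds (Gp z ω))) ∧
      Continuous (fun x : (ℂ × ℂ) × (ℤ → ↥P) => Gp x.1 x.2) ∧
      (∀ (z : ℂ × ℂ) (ω : ℤ → ↥P),
        Filter.Tendsto (fun n : ℕ => GMn ω n z) Filter.atTop (nhds (Gm z ω))) ∧
      Continuous (fun x : (ℂ × ℂ) × (ℤ → ↥P) => Gm x.1 x.2) := by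
  obtain ⟨A, hA1, hA⟩ := param_bound hPc (fun q => ‖q.2.1‖) (by
    intro n
    exact Continuous.continuousOn
      (by fun_prop : Continuous fun x : ℂ × ℂ × (Fin (n.1 + 1) → ℂ) => ‖x.1‖))
  obtain ⟨Δ, hΔ1, hΔ⟩ := param_bound hPc (fun q => ‖q.2.2.1‖) (by
    intro n
    exact Continuous.continuousOn
      (by fun_prop : Continuous fun x : ℂ × ℂ × (Fin (n.1 + 1) → ℂ) => ‖x.2.1‖))
  obtain ⟨S, hS1, hS⟩ := param_bound hPc (fun q => ∑ i, ‖q.2.2.2 i‖) (by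
    intro n
    exact Continuous.continuousOn
      (by fun_prop : Continuous fun x : ℂ × ℂ × (Fin (n.1 + 1) → ℂ) => ∑ i, ‖x.2.2 i‖))
  obtain ⟨E, hE1, hE⟩ := param_bound hPc (fun q => ‖q.2.2.1‖⁻¹) (by
    intro n
    refine ContinuousOn.inv₀ (Continuous.continuousOn
      (by fun_prop : Continuous fun x : ℂ × ℂ × (Fin (n.1 + 1) → ℂ) => ‖x.2.1‖)) fun x hx => ?_
    exact norm_ne_zero_iff.mpr (hP _ hx).1)
  obtain ⟨κ, hκ1, hκ⟩ := param_bound hPc (fun q => ‖q.2.2.2 0‖⁻¹) (by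
    intro n
    refine ContinuousOn.inv₀ (Continuous.continuousOn
      (by fun_prop : Continuous fun x : ℂ × ℂ × (Fin (n.1 + 1) → ℂ) => ‖x.2.2 0‖)) fun x hx => ?_
    exact norm_ne_zero_iff.mpr (hP _ hx).2)
  have hk : 0 < κ⁻¹ := by positivity
  have hkc : ∀ q ∈ P, κ⁻¹ ≤ ‖q.2.2.2 0‖ := fun q hq =>
    inv_le_of_inv_le₀ (norm_pos_iff.mpr (hP q hq).2) (hκ q hq)
  have hd : ∀ q : ↥P, 2 ≤ q.1.1.1 := fun q => hN _ q.1.1.2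
  have hdc : Continuous fun q : ↥P => ((q.1.1.1 : ℕ) : ℝ) := by
    have h := continuous_param_sub (P := P) (X := Unit) (fun q _ => ((q.1.1 : ℕ) : ℝ)) (by
      intro n
      exact continuousOn_const (c := ((n.1 : ℕ) : ℝ)))
    exact h.comp (continuous_id.prodMk (continuous_const (y := ())))
  have hFc : Continuous fun x : ↥P × (ℂ × ℂ) => fq x.1.1 x.2 := by
    refine continuous_param_sub (P := P) (X := ℂ × ℂ) (fun q z => fq q z) fun n => ?_
    refine Continuous.continuousOn ?_
    unfold fq
    have := continuous_pEval n.1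
    have h2 : Continuous fun x : (ℂ × ℂ × (Fin (n.1 + 1) → ℂ)) × (ℂ × ℂ) =>
        pEval n.1 x.1.2.2 x.2.2 :=
      this.comp (f := fun x : (ℂ × ℂ × (Fin (n.1 + 1) → ℂ)) × (ℂ × ℂ) => (x.1.2.2, x.2.2))
        (by fun_prop)
    exact (by fun_prop : Continuous fun x : (ℂ × ℂ × (Fin (n.1 + 1) → ℂ)) × (ℂ × ℂ) =>
      x.2.2 + x.1.1).prodMk (h2.sub (by fun_prop : Continuous fun x :
      (ℂ × ℂ × (Fin (n.1 + 1) → ℂ)) × (ℂ × ℂ) => x.1.2.1 * x.2.1))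
  have hIc : Continuous fun x : ↥P × (ℂ × ℂ) => (fqInv x.1.1 x.2.swap).swap := by
    refine continuous_param_sub (P := P) (X := ℂ × ℂ) (fun q z => (fqInv q z.swap).swap)
      fun n => ?_
    unfold fqInv
    have := continuous_pEval n.1
    have h2 : Continuous fun x : (ℂ × ℂ × (Fin (n.1 + 1) → ℂ)) × (ℂ × ℂ) =>
        pEval n.1 x.1.2.2 (x.2.2 - x.1.1) :=
      this.comp (f := fun x : (ℂ × ℂ × (Fin (n.1 + 1) → ℂ)) × (ℂ × ℂ) =>
        (x.1.2.2, x.2.2 - x.1.1)) (by fun_prop)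
    have h3 : ContinuousOn (fun x : (ℂ × ℂ × (Fin (n.1 + 1) → ℂ)) × (ℂ × ℂ) => (x.1.2.1)⁻¹)
        {x | (⟨n, x.1⟩ : Param N) ∈ P} :=
      ContinuousOn.inv₀ (Continuous.continuousOn (by fun_prop)) fun x hx => (hP _ hx).1
    exact (Continuous.continuousOn (by fun_prop :
      Continuous fun x : (ℂ × ℂ × (Fin (n.1 + 1) → ℂ)) × (ℂ × ℂ) => x.2.2 - x.1.1)).prodMk
      (h3.mul (h2.sub (by fun_prop)).continuousOn)
  set R0 : ℝ := 1 + 2 * S / κ⁻¹ with hR0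
  have hSk : 0 ≤ 2 * S / κ⁻¹ := by positivity
  have hlow : ∀ (q : ↥P) (y : ℂ), R0 ≤ ‖y‖ →
      κ⁻¹ / 2 * ‖y‖ ^ q.1.1.1 ≤ ‖pEval q.1.1.1 q.1.2.2.2 y‖ := fun q y hy =>
    pEval_lower _ (hd q) _ y _ S hk (hkc q q.2) (hS q q.2) (by linarith) (by linarith)
  have hupp : ∀ (q : ↥P) (y : ℂ),
      ‖pEval q.1.1.1 q.1.2.2.2 y‖ ≤ S * (max ‖y‖ 1) ^ q.1.1.1 := fun q y => by
    refine (pEval_upper _ _ y).trans ?_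
    gcongr
    exact hS q q.2
  obtain ⟨Gp, hGp, hGpc⟩ := henon_core (Q := ↥P) (Ω := ℤ → ↥P) (fun q => q.1.1.1) hd hdc
    (fun q z => fq q.1 z) hFc (fun q => q.1.2.1) (fun q => q.1.2.2.1)
    (fun q y => pEval q.1.1.1 q.1.2.2.2 y) (fun q z => rfl) A Δ S (κ⁻¹ / 2) R0
    (by positivity) (by linarith) (by linarith) (by linarith) (by linarith)
    (fun q => hA q q.2) (fun q => hΔ q q.2) hupp hlow
    (fun n ω => ω (n : ℤ)) (fun n => continuous_apply _)
    (fun n ω z => fwdP ω n z) (fun ω z => rfl) (fun n ω z => rfl)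
  have hD : ∀ q : ↥P, q.1.1.1 ≤ N.sup id := fun q => Finset.le_sup (f := id) q.1.1.2
  set D := N.sup id with hDdef
  obtain ⟨Gm, hGm, hGmc⟩ := henon_core (Q := ↥P) (Ω := ℤ → ↥P) (fun q => q.1.1.1) hd hdc
    (fun q z => (fqInv q.1 z.swap).swap) hIc (fun q => -q.1.2.1) (fun q => (q.1.2.2.1)⁻¹)
    (fun q y => (q.1.2.2.1)⁻¹ * pEval q.1.1.1 q.1.2.2.2 (y - q.1.2.1))
    (fun q z => by
      simp only [fqInv, Prod.swap, Prod.mk.injEq]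
      constructor <;> ring) A E (E * (S * (1 + A) ^ D)) (Δ⁻¹ * (κ⁻¹ / 2 * (1 / 2) ^ D))
    (2 * R0 + 2 * A)
    (by positivity) (by positivity) (by linarith) (by linarith) (by linarith)
    (fun q => by
      rw [norm_neg]
      exact hA q q.2) (fun q => by
      rw [norm_inv]
      exact hE q q.2)
    (fun q y => by
      have hq := hA q q.2
      rw [norm_mul, norm_inv, mul_assoc]
      have h1 := hE q q.2
      refine mul_le_mul h1 ((hupp q _).trans ?_) (norm_nonneg _) (by linarith)
      rw [mul_assoc]
      refine mul_le_mul_of_nonneg_left ?_ (by linarith)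
      have h2 : max ‖y - q.1.2.1‖ 1 ≤ (1 + A) * max ‖y‖ 1 := by
        have := norm_sub_le y q.1.2.1
        have m1 := le_max_left ‖y‖ 1
        have m2 := le_max_right ‖y‖ 1
        exact max_le (by nlinarith) (by nlinarith)
      calc (max ‖y - q.1.2.1‖ 1) ^ q.1.1.1 ≤ ((1 + A) * max ‖y‖ 1) ^ q.1.1.1 := by gcongr
        _ = (1 + A) ^ q.1.1.1 * (max ‖y‖ 1) ^ q.1.1.1 := mul_pow _ _ _
        _ ≤ (1 + A) ^ D * (max ‖y‖ 1) ^ q.1.1.1 := by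
          refine mul_le_mul_of_nonneg_right ?_ (by positivity)
          exact pow_le_pow_right₀ (by linarith) (hD q))
    (fun q y hy => by
      have hq := hA q q.2
      have h1 := norm_sub_norm_le y q.1.2.1
      have h2 : 1 / 2 * ‖y‖ ≤ ‖y - q.1.2.1‖ := by linarith
      have h3 : R0 ≤ ‖y - q.1.2.1‖ := by linarith
      rw [norm_mul, norm_inv, mul_assoc]
      refine mul_le_mul ?_ (le_trans ?_ (hlow q _ h3)) (by positivity) (by positivity)
      · exact inv_anti₀ (norm_pos_iff.mpr (hP q q.2).1) (hΔ q q.2)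
      · rw [mul_assoc]
        refine mul_le_mul_of_nonneg_left ?_ (by positivity)
        calc (1 / 2 : ℝ) ^ D * ‖y‖ ^ q.1.1.1 ≤ (1 / 2) ^ q.1.1.1 * ‖y‖ ^ q.1.1.1 := by
              refine mul_le_mul_of_nonneg_right ?_ (by positivity)
              exact pow_le_pow_of_le_one (by norm_num) (by norm_num) (hD q)
          _ = (1 / 2 * ‖y‖) ^ q.1.1.1 := (mul_pow _ _ _).symm
          _ ≤ ‖y - q.1.2.1‖ ^ q.1.1.1 := by gcongr)
    (fun n ω => ω (-((n : ℤ) + 1))) (fun n => continuous_apply _)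
    (fun n ω z => (bwdP ω n z.swap).swap) (fun ω z => rfl) (fun n ω z => rfl)
  refine ⟨Gp, fun z ω => Gm z.swap ω, hGp, hGpc, ?_, ?_⟩
  · intro z ω
    refine (hGm z.swap ω).congr fun n => ?_
    have : ∀ w : ℂ × ℂ, ‖w.swap‖ = ‖w‖ := fun w => by
      rw [Prod.norm_def, Prod.norm_def, max_comm]
      rfl
    rw [this]
    rfl
  · exact hGmc.comp ((continuous_swap.comp continuous_fst).prodMk continuous_snd)
end
end

section
/- With the compact parameter space P and the notation below: the set-valued map ω ∈ P^ℤ ↦ J_{γ(ω)}⁺ is lower semicontinuous; that is, for every ω ∈ P^ℤ, every z₀ ∈ J_{γ(ω)}⁺, and every sequence (ω^{(k)})_{k≥1} in P^ℤ converging to ω in the product topology, there exists a sequence (z_k)_{k≥1} in ℂ² with z_k ∈ J_{γ(ω^{(k)})}⁺ for every k and z_k → z₀ as k → ∞. The same statement holds with J⁺ replaced by J⁻. -/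
open Complex Filter Set Topology MeasureTheory Bornology

noncomputable section

lemma harnack_aux (f : ℂ → ℂ) (hf : Differentiable ℂ f)
    (h1 : ∀ t ∈ Metric.ball (0:ℂ) 2, 1 < ‖f t‖) :
    Real.log ‖f 1‖ ≤ 3 * Real.log ‖f 0‖ := by
  have hne : ∀ t ∈ Metric.ball (0:ℂ) 2, f t ≠ 0 := fun t ht h => by
    have := h1 t ht; rw [h] at this; simp at this; linarith
  have hh : InnerProductSpace.HarmonicOnNhd (fun t => Real.log ‖f t‖) (Metric.ball (0:ℂ) 2) := by
    intro t ht
    exact (hf.analyticAt t).harmonicAt_log_norm (hne t ht)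
  obtain ⟨g, hg, hre⟩ := hh.exists_analyticOnNhd_ball_re_eq
  have m0 : (0:ℂ) ∈ Metric.ball (0:ℂ) 2 := by simp
  have m1 : (1:ℂ) ∈ Metric.ball (0:ℂ) 2 := by simp
  have e0 := hre m0
  have e1 := hre m1
  simp only at e0 e1
  have key := Complex.borelCaratheodory_zero (f := fun t => g 0 - g t) (M := Real.log ‖f 0‖)
    (R := 2) (z := 1) (Real.log_pos (h1 0 m0))
    ((differentiableOn_const _).sub hg.differentiableOn) (by
      intro t ht
      have et := hre ht
      simp only at et
      have := Real.log_pos (h1 t ht)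
      simp at e0 et ⊢
      linarith) (by norm_num) m1 (by simp)
  have h2 := Complex.abs_re_le_norm (g 0 - g 1)
  have h3 := neg_abs_le (g 0 - g 1).re
  norm_num at key
  simp at e0 e1 h3
  simp at h2
  linarith

lemma pre_frontier {X : Type*} [TopologicalSpace X] {s t : Set X} (hs : IsPreconnected s)
   {w v : X} (hw : w ∈ s) (hwt : w ∉ t) (hv : v ∈ s) (hvt : v ∈ t) : (s ∩ frontier t).Nonempty := by
  by_contra h
  have h' : s ⊆ interior t ∪ (closure t)ᶜ := by
    intro x hx
    by_contra hc
    simp at hc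
    exact h ⟨x, hx, hc.2, hc.1⟩
  obtain ⟨x, hx, h1, h2⟩ := hs (interior t) (closure t)ᶜ isOpen_interior isClosed_closure.isOpen_compl h' 
    (by
      rcases h' hv with h | h
      · exact ⟨v, hv, h⟩
      · exact absurd (subset_closure hvt) h) (by
      rcases h' hw with h | h
      · exact absurd (interior_subset h) hwt
      · exact ⟨w, hw, h⟩)
  exact h2 (subset_closure (interior_subset h1))

/-- Abstract orbit. -/
def orb {Q : Type*} (F : Q → ℂ × ℂ → ℂ × ℂ) (q : ℕ → Q) : ℕ → ℂ × ℂ → ℂ × ℂ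
  | 0 => id
  | n + 1 => fun z => F (q n) (orb F q n z)

/-- The escaping region. -/
def VV (R : ℝ) : Set (ℂ × ℂ) := {z | R < ‖z.2‖ ∧ ‖z.1‖ < 2 * ‖z.2‖}

/-- Bounded orbits. -/
def KK {Q : Type*} (F : Q → ℂ × ℂ → ℂ × ℂ) (q : ℕ → Q) : Set (ℂ × ℂ) :=
  {z | IsBounded (Set.range fun n : ℕ => orb F q n z)}

theorem mem_KK {Q : Type*} (F : Q → ℂ × ℂ → ℂ × ℂ) (q : ℕ → Q) (z : ℂ × ℂ) :
    z ∈ KK F q ↔ ∃ M : ℝ, ∀ n, ‖orb F q n z‖ ≤ M := by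
  have : z ∈ KK F q ↔ IsBounded (Set.range fun n : ℕ => orb F q n z) := Iff.rfl
  rw [this, isBounded_iff_forall_norm_le]
  simp only [Set.forall_mem_range]

/-- Uniform estimates. -/
structure HSys {Q : Type*} [TopologicalSpace Q] (F : Q → ℂ × ℂ → ℂ × ℂ) (d : Q → ℕ)
    (c R C A : ℝ) : Prop where
  cont : Continuous fun p : Q × (ℂ × ℂ) => F p.1 p.2
  diff : ∀ q, Differentiable ℂ (F q)
  hd : ∀ q, 2 ≤ d q
  hc : 0 < c
  hc1 : c ≤ 1
  hR : 1 ≤ R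
  hcR : 2 ≤ c * R
  hC : 1 ≤ C
  hA : 0 ≤ A
  inv : ∀ q, ∀ z ∈ VV R, F q z ∈ VV R
  low : ∀ q, ∀ z ∈ VV R, c * ‖z.2‖ ^ d q ≤ ‖(F q z).2‖
  up : ∀ q z, max 1 ‖F q z‖ ≤ C * max 1 ‖z‖ ^ d q
  xb : ∀ q z, ‖(F q z).1‖ ≤ ‖z.2‖ + A

namespace HSys

variable {Q : Type*} [TopologicalSpace Q] {F : Q → ℂ × ℂ → ℂ × ℂ} {d : Q → ℕ}
  {c R C A : ℝ} (H : HSys F d c R C A)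

theorem orb_cont (H : HSys F d c R C A) (n : ℕ) :
    Continuous fun p : (ℕ → Q) × (ℂ × ℂ) => orb F p.1 n p.2 := by
  induction n with
  | zero => exact continuous_snd
  | succ n ih =>
    exact H.cont.comp (((continuous_apply n).comp continuous_fst).prodMk ih)

theorem orb_cont_z (H : HSys F d c R C A) (q : ℕ → Q) (n : ℕ) : Continuous (orb F q n) :=
  (H.orb_cont n).comp (continuous_const.prodMk continuous_id)

theorem orb_cont_q (H : HSys F d c R C A) (z : ℂ × ℂ) (n : ℕ) :
    Continuous (fun q => orb F q n z) :=
  (H.orb_cont n).comp (continuous_id.prodMk continuous_const)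

theorem orb_diff (H : HSys F d c R C A) (q : ℕ → Q) (n : ℕ) : Differentiable ℂ (orb F q n) := by
  induction n with
  | zero => exact differentiable_id
  | succ n ih => exact (H.diff _).comp ih

theorem orb_V (H : HSys F d c R C A) (q : ℕ → Q) {n m : ℕ} (hnm : n ≤ m) {z : ℂ × ℂ}
    (hz : orb F q n z ∈ VV R) : orb F q m z ∈ VV R := by
  induction m, hnm using Nat.le_induction with
  | base => exact hz
  | succ m _ ih => exact H.inv _ _ ih

theorem two_le (H : HSys F d c R C A) {z : ℂ × ℂ} (hz : z ∈ VV R) : 2 < c * ‖z.2‖ :=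
  lt_of_le_of_lt H.hcR (mul_lt_mul_of_pos_left hz.1 H.hc)

theorem lower (H : HSys F d c R C A) (q : ℕ → Q) {n : ℕ} {z : ℂ × ℂ}
    (hz : orb F q n z ∈ VV R) (k : ℕ) :
    (c * ‖(orb F q n z).2‖) ^ (∏ j ∈ Finset.range k, d (q (n + j)))
      ≤ c * ‖(orb F q (n + k) z).2‖ := by
  induction k with
  | zero => simp
  | succ k ih =>
    rw [Finset.prod_range_succ, pow_mul]
    have hV := H.orb_V q (Nat.le_add_right n k) hz
    have hl := H.low (q (n + k)) _ hV
    have hd := H.hd (q (n + k))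
    have hc := H.hc
    have : 0 < c * ‖(orb F q n z).2‖ := by linarith [H.two_le hz]
    calc _ ≤ (c * ‖(orb F q (n + k) z).2‖) ^ d (q (n + k)) := by gcongr
      _ = c ^ d (q (n + k)) * ‖(orb F q (n + k) z).2‖ ^ d (q (n + k)) := mul_pow _ _ _
      _ ≤ c ^ 2 * ‖(orb F q (n + k) z).2‖ ^ d (q (n + k)) := by
          gcongr ?_ * _
          exact pow_le_pow_of_le_one hc.le H.hc1 hd
      _ = c * (c * ‖(orb F q (n + k) z).2‖ ^ d (q (n + k))) := by ring
      _ ≤ c * ‖(orb F q (n + (k + 1)) z).2‖ := by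
          gcongr
          exact hl

theorem upper (H : HSys F d c R C A) (q : ℕ → Q) (n : ℕ) (z : ℂ × ℂ) (k : ℕ) :
    C * max 1 ‖orb F q (n + k) z‖
      ≤ (C * max 1 ‖orb F q n z‖) ^ (∏ j ∈ Finset.range k, d (q (n + j))) := by
  induction k with
  | zero => simp
  | succ k ih =>
    rw [Finset.prod_range_succ, pow_mul]
    have hu := H.up (q (n + k)) (orb F q (n + k) z)
    have hd := H.hd (q (n + k))
    have hC := H.hC
    calc C * max 1 ‖orb F q (n + (k + 1)) z‖
        ≤ C * (C * max 1 ‖orb F q (n + k) z‖ ^ d (q (n + k))) := by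
          gcongr
          exact hu
      _ = C ^ 2 * max 1 ‖orb F q (n + k) z‖ ^ d (q (n + k)) := by ring
      _ ≤ C ^ d (q (n + k)) * max 1 ‖orb F q (n + k) z‖ ^ d (q (n + k)) := by
          gcongr
      _ = (C * max 1 ‖orb F q (n + k) z‖) ^ d (q (n + k)) := (mul_pow _ _ _).symm
      _ ≤ _ := by gcongr

theorem two_pow_le (H : HSys F d c R C A) (q : ℕ → Q) (n k : ℕ) :
    2 ^ k ≤ ∏ j ∈ Finset.range k, d (q (n + j)) := by
  induction k with
  | zero => simp
  | succ k ih =>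
    rw [Finset.prod_range_succ, pow_succ]
    exact Nat.mul_le_mul ih (H.hd _)

theorem notK_of_V (H : HSys F d c R C A) (q : ℕ → Q) {n : ℕ} {z : ℂ × ℂ}
    (hz : orb F q n z ∈ VV R) : z ∉ KK F q := by
  intro hK
  obtain ⟨M, hM⟩ := (mem_KK F q z).1 hK
  obtain ⟨k, hk⟩ := pow_unbounded_of_one_lt M (one_lt_two)
  have h1 := H.lower q hz k
  have h2 : (2:ℝ) ^ k ≤ (c * ‖(orb F q n z).2‖) ^ (∏ j ∈ Finset.range k, d (q (n + j))) := by
    have h3 := H.two_pow_le q n k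
    have h4 : k ≤ ∏ j ∈ Finset.range k, d (q (n + j)) := (Nat.lt_two_pow_self).le.trans h3
    have h5 := H.two_le hz
    calc (2:ℝ) ^ k ≤ 2 ^ (∏ j ∈ Finset.range k, d (q (n + j))) := by
          gcongr
          norm_num
      _ ≤ _ := by gcongr
  have h6 : ‖orb F q (n + k) z‖ ≤ M := hM (n + k)
  have h7 := norm_snd_le (orb F q (n + k) z)
  have h8 : c * ‖(orb F q (n + k) z).2‖ ≤ 1 * ‖(orb F q (n + k) z).2‖ := by
    gcongr
    exact H.hc1
  linarith

theorem V_of_notK (H : HSys F d c R C A) (q : ℕ → Q) {z : ℂ × ℂ}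
    (hz : z ∉ KK F q) : ∃ n, orb F q n z ∈ VV R := by
  by_contra hcon
  push Not at hcon
  apply hz
  have hA := H.hA
  have hR := H.hR
  set M := max ‖z.1‖ (R + 2 * A) with hM
  have hM1 : R + 2 * A ≤ M := le_max_right _ _
  have hy : ∀ n, ‖(orb F q n z).1‖ ≤ M → ‖(orb F q n z).2‖ ≤ max R (M / 2) := by
    intro n hn
    have := hcon n
    simp only [VV, mem_ofPred_eq, not_and, not_lt] at this
    by_cases h : R < ‖(orb F q n z).2‖
    · have := this h
      exact le_max_of_le_right (by linarith)
    · exact le_max_of_le_left (not_lt.1 h)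
  have hx : ∀ n, ‖(orb F q n z).1‖ ≤ M := by
    intro n
    induction n with
    | zero => exact le_max_left _ _
    | succ n ih =>
      have h1 := H.xb (q n) (orb F q n z)
      have h2 := hy n ih
      have h3 : max R (M / 2) ≤ M - A := max_le (by linarith) (by linarith)
      calc _ ≤ _ := h1
        _ ≤ M := by linarith
  refine (mem_KK F q z).2 ⟨M, ?_⟩
  intro n
  have h2 := hy n (hx n)
  have h3 : max R (M / 2) ≤ M := max_le (by linarith) (by linarith)
  exact max_le (hx n) (h2.trans h3)

theorem isOpen_VV (R : ℝ) : IsOpen (VV R) := by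
  have h1 : IsOpen {z : ℂ × ℂ | R < ‖z.2‖} := isOpen_lt (by fun_prop) (by fun_prop)
  have h2 : IsOpen {z : ℂ × ℂ | ‖z.1‖ < 2 * ‖z.2‖} := isOpen_lt (by fun_prop) (by fun_prop)
  exact h1.inter h2

theorem isClosed_KK (H : HSys F d c R C A) (q : ℕ → Q) : IsClosed (KK F q) := by
  have : (KK F q)ᶜ = ⋃ n, orb F q n ⁻¹' VV R := by
    ext z
    simp only [mem_compl_iff, mem_iUnion, mem_preimage]
    exact ⟨H.V_of_notK q, fun ⟨n, hn⟩ => H.notK_of_V q hn⟩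
  rw [← isOpen_compl_iff, this]
  exact isOpen_iUnion fun n => (isOpen_VV R).preimage (H.orb_cont_z q n)

theorem unif (H : HSys F d c R C A) (q : ℕ → Q) {S : Set (ℂ × ℂ)} (hS : IsCompact S)
    (h : ∀ z ∈ S, z ∉ KK F q) : ∃ n, ∀ m, n ≤ m → ∀ z ∈ S, orb F q m z ∈ VV R := by
  obtain ⟨n, hn⟩ := hS.elim_directed_cover (fun n => orb F q n ⁻¹' VV R)
    (fun n => (isOpen_VV R).preimage (H.orb_cont_z q n))
    (fun z hz => mem_iUnion.2 (H.V_of_notK q (h z hz)))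
    (directed_of_isDirected_le fun a b hab z hz => H.orb_V q hab hz)
  exact ⟨n, fun m hm z hz => H.orb_V q hm (hn hz)⟩

theorem K_nonempty (H : HSys F d c R C A) (q : ℕ → Q) : (KK F q).Nonempty := by
  by_contra hne
  rw [not_nonempty_iff_eq_empty] at hne
  have hout : ∀ t : ℂ, R < ‖t‖ → ((0:ℂ), t) ∈ VV R := fun t ht => by
    refine ⟨ht, ?_⟩
    have := H.hR
    simp only [norm_zero]
    linarith
  obtain ⟨n, hn⟩ := H.unif q (S := (fun t : ℂ => ((0:ℂ), t)) '' Metric.closedBall 0 R)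
    ((isCompact_closedBall _ _).image (by fun_prop)) (fun z _ => by simp [hne])
  have hn := hn n le_rfl
  have hall : ∀ t : ℂ, orb F q n (0, t) ∈ VV R := by
    intro t
    by_cases ht : R < ‖t‖
    · exact H.orb_V q (Nat.zero_le n) (hout t ht)
    · exact hn _ ⟨t, by simpa using not_lt.1 ht, rfl⟩
  set f : ℂ → ℂ := fun t => (orb F q n (0, t)).2 with hf
  have hfd : Differentiable ℂ f := by
    have h1 := H.orb_diff q n
    have h2 : Differentiable ℂ (fun t : ℂ => ((0:ℂ), t)) := by fun_prop
    exact differentiable_snd.comp (h1.comp h2)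
  have hf0 : ∀ t, f t ≠ 0 := fun t h => by
    have h1 := (hall t).1
    have := H.hR
    change R < ‖f t‖ at h1
    rw [h, norm_zero] at h1
    linarith
  have hgrow : ∀ t : ℂ, R < ‖t‖ → c * ‖t‖ ≤ ‖f t‖ := by
    intro t ht
    have h0 : orb F q 0 (0, t) ∈ VV R := hout t ht
    have h1 := H.lower q h0 n
    rw [Nat.zero_add] at h1
    have h2 : 2 < c * ‖t‖ := H.two_le h0
    have h3 : (c * ‖t‖) ^ 1 ≤ (c * ‖t‖) ^ (∏ j ∈ Finset.range n, d (q (0 + j))) := by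
      apply pow_le_pow_right₀ (by linarith)
      exact (Nat.one_le_two_pow).trans (H.two_pow_le q 0 n)
    have h4 : c * ‖f t‖ ≤ 1 * ‖f t‖ := by
      gcongr
      exact H.hc1
    rw [pow_one] at h3
    have h5 : (c * ‖t‖) ^ (∏ j ∈ Finset.range n, d (q (0 + j))) ≤ c * ‖f t‖ := h1
    linarith
  have htend : Tendsto f (cocompact ℂ) (cobounded ℂ) := by
    rw [← tendsto_norm_atTop_iff_cobounded]
    refine tendsto_atTop_mono' _ ?_ ((tendsto_norm_cocompact_atTop (E := ℂ)).const_mul_atTop H.hc)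
    filter_upwards [(tendsto_norm_cocompact_atTop (E := ℂ)).eventually_gt_atTop R] with t ht
    exact hgrow t ht
  have := (hfd.inv hf0).apply_eq_of_tendsto_cocompact 0 (c := 0)
    (Filter.tendsto_inv₀_cobounded.comp htend)
  exact hf0 0 (inv_eq_zero.1 this)

theorem J_nonempty (H : HSys F d c R C A) (q : ℕ → Q) : (frontier (KK F q)).Nonempty := by
  rw [nonempty_frontier_iff]
  refine ⟨H.K_nonempty q, fun h => ?_⟩
  have h0 : orb F q 0 (0, ((R + 1 : ℝ) : ℂ)) ∈ VV R := by
    have := H.hR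
    have h2 : ‖((R + 1 : ℝ) : ℂ)‖ = R + 1 := by
      rw [Complex.norm_real, Real.norm_of_nonneg (by linarith)]
    constructor
    · change R < ‖((R + 1 : ℝ) : ℂ)‖
      rw [h2]; linarith
    · change ‖(0:ℂ)‖ < 2 * ‖((R + 1 : ℝ) : ℂ)‖
      rw [h2, norm_zero]; linarith
  exact H.notK_of_V q h0 (h ▸ mem_univ _)

theorem local_lsc (H : HSys F d c R C A) (q : ℕ → Q) {z₀ : ℂ × ℂ} (hz₀ : z₀ ∈ frontier (KK F q))
    {ε : ℝ} (hε : 0 < ε) :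
    ∀ᶠ r in 𝓝 q, (Metric.ball z₀ ε ∩ frontier (KK F r)).Nonempty := by
  have hzK : z₀ ∈ KK F q := (H.isClosed_KK q).frontier_subset hz₀
  obtain ⟨w, hwb, hwK⟩ : ∃ w ∈ Metric.ball z₀ (ε / 4), w ∉ KK F q := by
    have h1 : z₀ ∈ closure (KK F q)ᶜ := by
      rw [frontier_eq_closure_inter_closure] at hz₀
      exact hz₀.2
    obtain ⟨w, hw, hd⟩ := Metric.mem_closure_iff.1 h1 (ε / 4) (by linarith)
    exact ⟨w, by rwa [Metric.mem_ball, dist_comm], hw⟩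
  obtain ⟨m0, hm0⟩ := H.V_of_notK q hwK
  obtain ⟨M, hM⟩ := (mem_KK F q z₀).1 hzK
  have hM0 : 0 ≤ M := (norm_nonneg _).trans (hM 0)
  set L := C * (M + 1) with hL
  have hL1 : 1 ≤ L := by
    have := H.hC
    nlinarith
  obtain ⟨k, hk⟩ := pow_unbounded_of_one_lt (3 * Real.log L / Real.log 2) (one_lt_two)
  have hlog2 : 0 < Real.log 2 := Real.log_pos one_lt_two
  rw [div_lt_iff₀ hlog2] at hk
  have ev1 : ∀ᶠ r in 𝓝 q, orb F r m0 w ∈ VV R :=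
    (H.orb_cont_q w m0).continuousAt.eventually ((isOpen_VV R).mem_nhds hm0)
  have ev2 : ∀ᶠ r in 𝓝 q, ‖orb F r (m0 + k) z₀‖ < M + 1 := by
    refine (H.orb_cont_q z₀ (m0 + k)).norm.continuousAt.eventually_lt_const ?_
    have : ‖orb F q (m0 + k) z₀‖ ≤ M := hM (m0 + k)
    linarith
  filter_upwards [ev1, ev2] with r hr1 hr2
  have hwr := H.notK_of_V r hr1
  have hwε : w ∈ Metric.ball z₀ ε := Metric.ball_subset_ball (by linarith) hwb
  by_cases hex : ∃ v ∈ Metric.ball z₀ ε, v ∈ KK F r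
  · obtain ⟨v, hv, hvK⟩ := hex
    exact pre_frontier (convex_ball z₀ ε).isPreconnected hwε hwr hv hvK
  exfalso
  push Not at hex
  obtain ⟨n, hn⟩ := H.unif r (isCompact_closedBall z₀ (ε / 2))
    (fun z hz => hex z (Metric.closedBall_subset_ball (by linarith) hz))
  have hn := hn (m0 + k + n) (by omega)
  set f : ℂ → ℂ := fun t => c * (orb F r (m0 + k + n) (z₀ + t • (w - z₀))).2 with hf
  have hfd : Differentiable ℂ f := by
    have h1 := H.orb_diff r (m0 + k + n)
    have h2 : Differentiable ℂ (fun t : ℂ => z₀ + t • (w - z₀)) := by fun_prop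
    exact (differentiable_snd.comp (h1.comp h2)).const_mul _
  have hfn : ∀ t, ‖f t‖ = c * ‖(orb F r (m0 + k + n) (z₀ + t • (w - z₀))).2‖ := fun t => by
    rw [hf]
    simp only [norm_mul, Complex.norm_real, Real.norm_of_nonneg H.hc.le]
  have hf1 : ∀ t ∈ Metric.ball (0:ℂ) 2, 1 < ‖f t‖ := by
    intro t ht
    rw [hfn]
    have h1 : z₀ + t • (w - z₀) ∈ Metric.closedBall z₀ (ε / 2) := by
      rw [Metric.mem_closedBall, dist_eq_norm, add_sub_cancel_left, norm_smul]
      rw [Metric.mem_ball, dist_eq_norm] at hwb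
      rw [mem_ball_zero_iff] at ht
      nlinarith [norm_nonneg t, norm_nonneg (w - z₀)]
    linarith [H.two_le (hn _ h1)]
  have hh := harnack_aux f hfd hf1
  set D := ∏ j ∈ Finset.range n, d (r (m0 + k + j)) with hD
  have hDpos : 0 < D := lt_of_lt_of_le (by positivity) (H.two_pow_le r (m0 + k) n)
  have hup : ‖f 0‖ ≤ L ^ D := by
    rw [hfn, zero_smul, add_zero]
    have hC := H.hC
    have hc1 := H.hc1
    have hc := H.hc
    calc c * ‖(orb F r (m0 + k + n) z₀).2‖ ≤ C * max 1 ‖orb F r (m0 + k + n) z₀‖ := by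
          gcongr
          · linarith
          · exact (norm_snd_le _).trans (le_max_right _ _)
      _ ≤ _ := H.upper r (m0 + k) z₀ n
      _ ≤ L ^ D := by
          rw [hL]
          gcongr
          exact max_le (by linarith) hr2.le
  have hlo : (2:ℝ) ^ (2 ^ k * D) ≤ ‖f 1‖ := by
    rw [hfn, one_smul, add_sub_cancel]
    have h1 := H.lower r hr1 k
    have h2 := H.lower r (H.orb_V r (Nat.le_add_right m0 k) hr1) n
    have h3 := H.two_le hr1
    refine le_trans ?_ h2
    rw [pow_mul]
    gcongr
    refine le_trans ?_ h1
    calc (2:ℝ) ^ (2 ^ k) ≤ 2 ^ (∏ j ∈ Finset.range k, d (r (m0 + j))) := by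
          gcongr
          · norm_num
          · exact H.two_pow_le r m0 k
      _ ≤ _ := by gcongr
  have h0pos : 0 < ‖f 0‖ := lt_trans one_pos (hf1 0 (by simp))
  have l1 := Real.log_le_log h0pos hup
  have l2 := Real.log_le_log (by positivity) hlo
  rw [Real.log_pow] at l1 l2
  push_cast at l2
  have hDp : (0:ℝ) < D := by exact_mod_cast hDpos
  nlinarith

theorem lsc (H : HSys F d c R C A) (q : ℕ → Q) {z₀ : ℂ × ℂ} (hz₀ : z₀ ∈ frontier (KK F q))
    (qs : ℕ → ℕ → Q) (hqs : Tendsto qs atTop (𝓝 q)) :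
    ∃ zs : ℕ → ℂ × ℂ, (∀ k, zs k ∈ frontier (KK F (qs k))) ∧ Tendsto zs atTop (𝓝 z₀) := by
  have hcl : ∀ k, ∃ z ∈ frontier (KK F (qs k)),
      Metric.infDist z₀ (frontier (KK F (qs k))) = dist z₀ z := fun k =>
    isClosed_frontier.exists_infDist_eq_dist (H.J_nonempty (qs k)) z₀
  choose zs hzs hdist using hcl
  refine ⟨zs, hzs, ?_⟩
  rw [Metric.tendsto_nhds]
  intro ε hε
  filter_upwards [hqs.eventually (H.local_lsc q hz₀ hε)] with k hk
  obtain ⟨v, hv, hvJ⟩ := hk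
  rw [dist_comm, ← hdist]
  exact lt_of_le_of_lt (Metric.infDist_le_dist_of_mem hvJ) (by rwa [dist_comm])

end HSys

theorem mk_HSys {Q : Type*} [TopologicalSpace Q] (F : Q → ℂ × ℂ → ℂ × ℂ) (d : Q → ℕ)
    (a δ : Q → ℂ) (p : Q → ℂ → ℂ)
    (hF : ∀ q z, F q z = (z.2 + a q, p q z.2 - δ q * z.1))
    (cont : Continuous fun x : Q × (ℂ × ℂ) => F x.1 x.2)
    (diff : ∀ q, Differentiable ℂ (F q)) (hd : ∀ q, 2 ≤ d q)
    (B c R₀ : ℝ) (hB : 1 ≤ B) (hc : 0 < c) (hc1 : c ≤ 1) (hR₀ : 0 ≤ R₀)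
    (ha : ∀ q, ‖a q‖ ≤ B) (hδ : ∀ q, ‖δ q‖ ≤ B)
    (hup : ∀ q y, ‖p q y‖ ≤ B * max 1 ‖y‖ ^ d q)
    (hlow : ∀ q y, R₀ ≤ ‖y‖ → 2 * c * ‖y‖ ^ d q ≤ ‖p q y‖) :
    HSys F d c (1 + R₀ + B + (2 + 2 * B) / c) (1 + 2 * B) B := by
  have hpos : 0 ≤ (2 + 2 * B) / c := by positivity
  have hcR : 2 + 2 * B ≤ c * (1 + R₀ + B + (2 + 2 * B) / c) := by
    have : c * ((2 + 2 * B) / c) = 2 + 2 * B := by field_simp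
    have h2 : 0 ≤ c * (1 + R₀ + B) := by positivity
    linarith
  have main : ∀ q, ∀ z ∈ VV (1 + R₀ + B + (2 + 2 * B) / c),
      c * ‖z.2‖ ^ d q ≤ ‖(F q z).2‖ := by
    intro q z hz
    obtain ⟨h1, h2⟩ := hz
    rw [hF]
    have hl := hlow q z.2 (by linarith)
    have hy1 : 1 ≤ ‖z.2‖ := by linarith
    have hcy : 2 + 2 * B ≤ c * ‖z.2‖ := hcR.trans (by gcongr)
    have h3 : 2 * B * ‖z.2‖ ≤ c * ‖z.2‖ ^ d q := by
      calc 2 * B * ‖z.2‖ ≤ (c * ‖z.2‖) * ‖z.2‖ :=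
            mul_le_mul_of_nonneg_right (by linarith) (by linarith)
        _ = c * ‖z.2‖ ^ 2 := by ring
        _ ≤ c * ‖z.2‖ ^ d q := by gcongr; exact hd q
    have h4 : ‖δ q * z.1‖ ≤ B * (2 * ‖z.2‖) := by
      rw [norm_mul]
      gcongr
      exact hδ q
    have h5 := norm_sub_norm_le (p q z.2) (δ q * z.1)
    change c * ‖z.2‖ ^ d q ≤ ‖p q z.2 - δ q * z.1‖
    linarith
  refine ⟨cont, diff, hd, hc, hc1, by linarith, by linarith, by linarith, by linarith, ?_, main,
    ?_, ?_⟩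
  · intro q z hz
    have hm := main q z hz
    obtain ⟨h1, h2⟩ := hz
    have hy1 : 1 ≤ ‖z.2‖ := by linarith
    have hcy : 2 + 2 * B ≤ c * ‖z.2‖ := hcR.trans (by gcongr)
    have h3 : 2 * ‖z.2‖ ≤ ‖(F q z).2‖ := by
      calc 2 * ‖z.2‖ ≤ (c * ‖z.2‖) * ‖z.2‖ :=
            mul_le_mul_of_nonneg_right (by linarith) (by linarith)
        _ = c * ‖z.2‖ ^ 2 := by ring
        _ ≤ c * ‖z.2‖ ^ d q := by gcongr; exact hd q
        _ ≤ _ := hm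
    refine ⟨by linarith, ?_⟩
    have h4 : ‖(F q z).1‖ ≤ ‖z.2‖ + B := by
      rw [hF]
      exact (norm_add_le _ _).trans (by gcongr; exact ha q)
    linarith
  · intro q z
    have hm : 1 ≤ max 1 ‖z‖ := le_max_left _ _
    have hmd : max 1 ‖z‖ ≤ max 1 ‖z‖ ^ d q := le_self_pow₀ hm (by have := hd q; omega)
    have hm1 : 1 ≤ max 1 ‖z‖ ^ d q := hm.trans hmd
    have hz1 : ‖z.1‖ ≤ max 1 ‖z‖ := (norm_fst_le z).trans (le_max_right _ _)
    have hz2 : ‖z.2‖ ≤ max 1 ‖z‖ := (norm_snd_le z).trans (le_max_right _ _)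
    refine max_le (by nlinarith) ?_
    rw [hF]
    refine max_le ?_ ?_
    · refine (norm_add_le _ _).trans ?_
      have := ha q
      change ‖z.2‖ + ‖a q‖ ≤ _
      nlinarith
    · refine (norm_sub_le _ _).trans ?_
      have h1 : ‖p q z.2‖ ≤ B * max 1 ‖z‖ ^ d q := by
        refine (hup q z.2).trans ?_
        gcongr
        exact norm_snd_le z
      have h2 : ‖δ q * z.1‖ ≤ B * max 1 ‖z‖ ^ d q := by
        rw [norm_mul]
        gcongr
        · exact hδ q
        · exact hz1.trans hmd
      change ‖p q z.2‖ + ‖δ q * z.1‖ ≤ _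
      linarith
  · intro q z
    rw [hF]
    exact (norm_add_le _ _).trans (by gcongr; exact ha q)

theorem pEval_up (n : ℕ) (c : Fin (n + 1) → ℂ) (y : ℂ) :
    ‖pEval n c y‖ ≤ (∑ i, ‖c i‖) * max 1 ‖y‖ ^ n := by
  unfold pEval
  refine (norm_sum_le _ _).trans ?_
  rw [Finset.sum_mul]
  refine Finset.sum_le_sum fun i _ => ?_
  rw [norm_mul, norm_pow]
  gcongr
  calc ‖y‖ ^ (n - (i:ℕ)) ≤ max 1 ‖y‖ ^ (n - (i:ℕ)) := by gcongr; exact le_max_right _ _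
    _ ≤ max 1 ‖y‖ ^ n := pow_le_pow_right₀ (le_max_left _ _) (Nat.sub_le _ _)

theorem pEval_low (n : ℕ) (c : Fin (n + 1) → ℂ) (y : ℂ) (hy : 1 ≤ ‖y‖) :
    ‖c 0‖ * ‖y‖ ^ n ≤ ‖pEval n c y‖ + (∑ i, ‖c i‖) * ‖y‖ ^ (n - 1) := by
  have h1 : c 0 * y ^ n = pEval n c y - ∑ i : Fin n, c i.succ * y ^ (n - (i.succ : ℕ)) := by
    unfold pEval
    rw [Fin.sum_univ_succ]
    simp
  have h2 : ‖∑ i : Fin n, c i.succ * y ^ (n - (i.succ : ℕ))‖ ≤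
      (∑ i, ‖c i‖) * ‖y‖ ^ (n - 1) := by
    refine (norm_sum_le _ _).trans ?_
    rw [Fin.sum_univ_succ, add_mul, Finset.sum_mul]
    have h0 : 0 ≤ ‖c 0‖ * ‖y‖ ^ (n - 1) := by positivity
    refine le_add_of_nonneg_of_le h0 (Finset.sum_le_sum fun i _ => ?_)
    rw [norm_mul, norm_pow]
    gcongr
    simp
  rw [← norm_pow, ← norm_mul, h1]
  exact (norm_sub_le _ _).trans (by linarith)

theorem pEval_low' (n : ℕ) (hn : 1 ≤ n) (c : Fin (n + 1) → ℂ) (B : ℝ) (hB : 1 ≤ B)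
    (hS : ∑ i, ‖c i‖ ≤ B) (h0 : c 0 ≠ 0) (hc0 : ‖(c 0)⁻¹‖ ≤ B) (y : ℂ)
    (hy : 2 * B ^ 2 ≤ ‖y‖) : (2 * B)⁻¹ * ‖y‖ ^ n ≤ ‖pEval n c y‖ := by
  have hy1 : 1 ≤ ‖y‖ := by nlinarith
  have h1 := pEval_low n c y hy1
  obtain ⟨m, rfl⟩ : ∃ m, n = m + 1 := ⟨n - 1, by omega⟩
  rw [Nat.add_sub_cancel] at h1
  have h2 : B⁻¹ ≤ ‖c 0‖ := by
    rw [norm_inv] at hc0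
    exact inv_le_of_inv_le₀ (norm_pos_iff.2 h0) hc0
  have h3 : (∑ i, ‖c i‖) * ‖y‖ ^ m ≤ (2 * B)⁻¹ * ‖y‖ ^ (m + 1) := by
    calc (∑ i, ‖c i‖) * ‖y‖ ^ m ≤ B * ‖y‖ ^ m := by gcongr
      _ = (2 * B)⁻¹ * ((2 * B ^ 2) * ‖y‖ ^ m) := by field_simp
      _ ≤ (2 * B)⁻¹ * (‖y‖ * ‖y‖ ^ m) := by gcongr
      _ = _ := by ring
  have h4 : B⁻¹ * ‖y‖ ^ (m + 1) ≤ ‖c 0‖ * ‖y‖ ^ (m + 1) := by gcongr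
  have h5 : B⁻¹ = (2 * B)⁻¹ + (2 * B)⁻¹ := by field_simp; norm_num
  rw [h5, add_mul] at h4
  linarith

theorem pEval_diff (n : ℕ) (c : Fin (n + 1) → ℂ) : Differentiable ℂ (pEval n c) := by
  unfold pEval
  fun_prop

theorem cont_pEval (N : Finset ℕ) :
    Continuous fun x : Param N × ℂ => pEval x.1.1.1 x.1.2.2.2 x.2 := by
  rw [← (Homeomorph.sigmaProdDistrib
    (X := fun n : {m : ℕ // m ∈ N} => ℂ × ℂ × (Fin (n.1 + 1) → ℂ))
    (Y := ℂ)).symm.comp_continuous_iff']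
  refine continuous_sigma fun n => ?_
  change Continuous fun x : (ℂ × ℂ × (Fin (n.1 + 1) → ℂ)) × ℂ => pEval n.1 x.1.2.2 x.2
  unfold pEval
  fun_prop

theorem cont_a (N : Finset ℕ) : Continuous fun q : Param N => q.2.1 :=
  continuous_sigma fun n => by
    change Continuous fun x : (ℂ × ℂ × (Fin (n.1 + 1) → ℂ)) => x.1
    fun_prop

theorem cont_δ (N : Finset ℕ) : Continuous fun q : Param N => q.2.2.1 :=
  continuous_sigma fun n => by
    change Continuous fun x : (ℂ × ℂ × (Fin (n.1 + 1) → ℂ)) => x.2.1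
    fun_prop

theorem cont_c0 (N : Finset ℕ) : Continuous fun q : Param N => q.2.2.2 0 :=
  continuous_sigma fun n => by
    change Continuous fun x : (ℂ × ℂ × (Fin (n.1 + 1) → ℂ)) => x.2.2 0
    fun_prop

theorem cont_S (N : Finset ℕ) : Continuous fun q : Param N => ∑ i, ‖q.2.2.2 i‖ :=
  continuous_sigma fun n => by
    change Continuous fun x : (ℂ × ℂ × (Fin (n.1 + 1) → ℂ)) => ∑ i, ‖x.2.2 i‖
    fun_prop

theorem exists_B (N : Finset ℕ) (P : Set (Param N)) (hPc : IsCompact P)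
    (hP : ∀ q ∈ P, q.2.2.1 ≠ 0 ∧ q.2.2.2 0 ≠ 0) :
    ∃ B : ℝ, 1 ≤ B ∧ ∀ q ∈ P, ‖q.2.1‖ ≤ B ∧ ‖q.2.2.1‖ ≤ B ∧ ‖q.2.2.1⁻¹‖ ≤ B ∧
      ∑ i, ‖q.2.2.2 i‖ ≤ B ∧ ‖(q.2.2.2 0)⁻¹‖ ≤ B := by
  have hc : ContinuousOn (fun q : Param N => ‖q.2.1‖ + ‖q.2.2.1‖ + ‖q.2.2.1⁻¹‖ +
      ∑ i, ‖q.2.2.2 i‖ + ‖(q.2.2.2 0)⁻¹‖) P := by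
    refine ContinuousOn.add (ContinuousOn.add (ContinuousOn.add (ContinuousOn.add ?_ ?_) ?_) ?_) ?_
    · exact (cont_a N).norm.continuousOn
    · exact (cont_δ N).norm.continuousOn
    · exact ((cont_δ N).continuousOn.inv₀ fun q hq => (hP q hq).1).norm
    · exact (cont_S N).continuousOn
    · exact ((cont_c0 N).continuousOn.inv₀ fun q hq => (hP q hq).2).norm
  obtain ⟨B, hB⟩ := hPc.exists_bound_of_continuousOn hc
  refine ⟨max 1 B, le_max_left _ _, fun q hq => ?_⟩
  have h := (le_abs_self _).trans (hB q hq)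
  have h1 := norm_nonneg q.2.1
  have h2 := norm_nonneg q.2.2.1
  have h3 := norm_nonneg q.2.2.1⁻¹
  have h4 : 0 ≤ ∑ i, ‖q.2.2.2 i‖ := Finset.sum_nonneg fun _ _ => norm_nonneg _
  have h5 := norm_nonneg (q.2.2.2 0)⁻¹
  have h6 := le_max_right 1 B
  refine ⟨?_, ?_, ?_, ?_, ?_⟩ <;> linarith

theorem fwd_HSys (N : Finset ℕ) (hN : ∀ n ∈ N, 2 ≤ n)
    (P : Set (Param N)) (hPc : IsCompact P)
    (hP : ∀ q ∈ P, q.2.2.1 ≠ 0 ∧ q.2.2.2 0 ≠ 0) :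
    ∃ c R C A, HSys (fun q : P => fq (q : Param N)) (fun q => q.1.1.1) c R C A := by
  obtain ⟨B, hB, hb⟩ := exists_B N P hPc hP
  refine ⟨_, _, _, _, mk_HSys (fun q : P => fq (q : Param N)) (fun q => q.1.1.1)
    (fun q => q.1.2.1) (fun q => q.1.2.2.1) (fun q => pEval q.1.1.1 q.1.2.2.2)
    (fun _ _ => rfl) ?_ ?_ (fun q => hN _ q.1.1.2) B ((4 * B)⁻¹) (2 * B ^ 2) hB (by positivity)
    (inv_le_one_of_one_le₀ (by linarith)) (by positivity)
    (fun q => (hb q.1 q.2).1) (fun q => (hb q.1 q.2).2.1) ?_ ?_⟩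
  · unfold fq
    have h1 := (cont_a N).comp (continuous_subtype_val.comp
      (continuous_fst (X := P) (Y := ℂ × ℂ)))
    have h2 := (cont_δ N).comp (continuous_subtype_val.comp
      (continuous_fst (X := P) (Y := ℂ × ℂ)))
    have h3 := (cont_pEval N).comp ((continuous_subtype_val.comp
      (continuous_fst (X := P) (Y := ℂ × ℂ))).prodMk (continuous_snd.comp continuous_snd))
    exact ((continuous_snd.comp continuous_snd).add h1).prodMk
      (h3.sub (h2.mul (continuous_fst.comp continuous_snd)))
  · intro q
    have h := (pEval_diff q.1.1.1 q.1.2.2.2).comp (differentiable_snd (𝕜 := ℂ) (E := ℂ) (F := ℂ))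
    exact (differentiable_snd.add_const _).prodMk (h.sub (differentiable_fst.const_mul _))
  · intro q y
    refine (pEval_up _ _ _).trans ?_
    gcongr
    exact (hb q.1 q.2).2.2.2.1
  · intro q y hy
    have h := pEval_low' q.1.1.1 (by have := hN _ q.1.1.2; omega) q.1.2.2.2 B hB
      (hb q.1 q.2).2.2.2.1 (hP q.1 q.2).2 (hb q.1 q.2).2.2.2.2 y hy
    have e : 2 * (4 * B)⁻¹ = (2 * B)⁻¹ := by field_simp; norm_num
    rw [e]
    exact h

theorem bwd_HSys (N : Finset ℕ) (hN : ∀ n ∈ N, 2 ≤ n)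
    (P : Set (Param N)) (hPc : IsCompact P)
    (hP : ∀ q ∈ P, q.2.2.1 ≠ 0 ∧ q.2.2.2 0 ≠ 0) :
    ∃ c R C A, HSys (fun (q : P) z => (fqInv (q : Param N) z.swap).swap)
      (fun q => q.1.1.1) c R C A := by
  obtain ⟨B, hB, hb⟩ := exists_B N P hPc hP
  have hD : ∀ q : P, q.1.1.1 ≤ N.sup id := fun q => Finset.le_sup (f := id) q.1.1.2
  set D := N.sup id with hDdef
  have hB2 : B ≤ B * (B * (1 + B) ^ D) := by
    have : 1 ≤ (1 + B) ^ D := one_le_pow₀ (by linarith)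
    have : 1 ≤ B * (1 + B) ^ D := by nlinarith
    nlinarith
  refine ⟨_, _, _, _, mk_HSys (fun (q : P) z => (fqInv (q : Param N) z.swap).swap)
    (fun q => q.1.1.1)
    (fun q => - q.1.2.1) (fun q => q.1.2.2.1⁻¹)
    (fun q y => q.1.2.2.1⁻¹ * pEval q.1.1.1 q.1.2.2.2 (y - q.1.2.1))
    ?_ ?_ ?_ (fun q => hN _ q.1.1.2) (B * (B * (1 + B) ^ D)) ((4 * B ^ 2 * 2 ^ D)⁻¹)
    (4 * B ^ 2 + 2 * B) (by linarith) (by positivity)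
    (inv_le_one_of_one_le₀ ?_) (by positivity)
    (fun q => by rw [norm_neg]; exact (hb q.1 q.2).1.trans hB2)
    (fun q => (hb q.1 q.2).2.2.1.trans hB2) ?_ ?_⟩
  · intro q z
    simp only [fqInv, Prod.swap]
    ext <;> simp <;> ring
  · unfold fqInv
    have h1 := (cont_a N).comp (continuous_subtype_val.comp
      (continuous_fst (X := P) (Y := ℂ × ℂ)))
    have h2 : Continuous fun x : P × (ℂ × ℂ) => (x.1.1.2.2.1)⁻¹ :=
      ((cont_δ N).comp (continuous_subtype_val.comp
        (continuous_fst (X := P) (Y := ℂ × ℂ)))).inv₀ fun x => (hP x.1.1 x.1.2).1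
    have h4 : Continuous fun x : P × (ℂ × ℂ) => x.2.2 - x.1.1.2.1 :=
      (continuous_snd.comp continuous_snd).sub h1
    have h3 := (cont_pEval N).comp ((continuous_subtype_val.comp
      (continuous_fst (X := P) (Y := ℂ × ℂ))).prodMk h4)
    exact h4.prodMk (h2.mul (h3.sub (continuous_fst.comp continuous_snd)))
  · intro q
    have h4 : Differentiable ℂ fun x : ℂ × ℂ => x.2 - q.1.2.1 := differentiable_snd.sub_const _
    have h := (pEval_diff q.1.1.1 q.1.2.2.2).comp h4
    exact h4.prodMk ((h.sub differentiable_fst).const_mul _)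
  · have : (1:ℝ) ≤ 2 ^ D := one_le_pow₀ (by norm_num)
    nlinarith
  · intro q y
    obtain ⟨b1, b2, b3, b4, b5⟩ := hb q.1 q.2
    have h1 := pEval_up q.1.1.1 q.1.2.2.2 (y - q.1.2.1)
    have hm : 1 ≤ max 1 ‖y‖ := le_max_left _ _
    have h2 : max 1 ‖y - q.1.2.1‖ ≤ (1 + B) * max 1 ‖y‖ := by
      refine max_le (by nlinarith) ?_
      have := norm_sub_le y q.1.2.1
      have := le_max_right 1 ‖y‖
      nlinarith
    rw [norm_mul]
    calc ‖q.1.2.2.1⁻¹‖ * ‖pEval q.1.1.1 q.1.2.2.2 (y - q.1.2.1)‖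
        ≤ B * (B * ((1 + B) * max 1 ‖y‖) ^ q.1.1.1) := by
          gcongr
          refine h1.trans ?_
          gcongr
      _ = B * (B * (1 + B) ^ q.1.1.1) * max 1 ‖y‖ ^ q.1.1.1 := by rw [mul_pow]; ring
      _ ≤ B * (B * (1 + B) ^ D) * max 1 ‖y‖ ^ q.1.1.1 := by
          gcongr
          · linarith
          · exact hD q
  · intro q y hy
    obtain ⟨b1, b2, b3, b4, b5⟩ := hb q.1 q.2
    have hya : ‖y‖ / 2 ≤ ‖y - q.1.2.1‖ := by
      have := norm_sub_norm_le y q.1.2.1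
      nlinarith
    have h := pEval_low' q.1.1.1 (by have := hN _ q.1.1.2; omega) q.1.2.2.2 B hB
      b4 (hP q.1 q.2).2 b5 (y - q.1.2.1) (by linarith)
    have h2 : B⁻¹ ≤ ‖q.1.2.2.1⁻¹‖ := by
      rw [norm_inv]
      exact inv_anti₀ (norm_pos_iff.2 (hP q.1 q.2).1) b2
    have h3 : (2:ℝ) ^ q.1.1.1 ≤ 2 ^ D := by
      gcongr
      · norm_num
      · exact hD q
    rw [norm_mul]
    calc 2 * (4 * B ^ 2 * 2 ^ D)⁻¹ * ‖y‖ ^ q.1.1.1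
        = B⁻¹ * ((2 * B)⁻¹ * ((2 ^ D)⁻¹ * ‖y‖ ^ q.1.1.1)) := by field_simp; norm_num
      _ ≤ B⁻¹ * ((2 * B)⁻¹ * ((2 ^ q.1.1.1)⁻¹ * ‖y‖ ^ q.1.1.1)) := by gcongr
      _ = B⁻¹ * ((2 * B)⁻¹ * (‖y‖ / 2) ^ q.1.1.1) := by rw [div_pow]; ring
      _ ≤ B⁻¹ * ((2 * B)⁻¹ * ‖y - q.1.2.1‖ ^ q.1.1.1) := by gcongr
      _ ≤ _ := by gcongr

theorem KPlus_eq {N : Finset ℕ} {P : Set (Param N)} (ω : ℤ → ↥P) :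
    KPlusP ω = KK (fun q : P => fq (q : Param N)) (fun n : ℕ => ω n) := by
  have : ∀ n z, fwdP ω n z = orb (fun q : P => fq (q : Param N)) (fun n : ℕ => ω n) n z := by
    intro n z
    induction n with
    | zero => rfl
    | succ n ih => simp only [fwdP, orb, ih]
  simp only [KPlusP, KK, this]

theorem KMinus_eq {N : Finset ℕ} {P : Set (Param N)} (ω : ℤ → ↥P) :
    KMinusP ω = Homeomorph.prodComm ℂ ℂ ⁻¹'
      KK (fun (q : P) z => (fqInv (q : Param N) z.swap).swap)
        (fun n : ℕ => ω (-((n : ℤ) + 1))) := by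
  have : ∀ n z, orb (fun (q : P) z => (fqInv (q : Param N) z.swap).swap)
      (fun n : ℕ => ω (-((n : ℤ) + 1))) n (Prod.swap z) = (bwdP ω n z).swap := by
    intro n z
    induction n with
    | zero => rfl
    | succ n ih => simp only [bwdP, orb, ih, Prod.swap_swap]
  ext z
  have h1 : z ∈ KMinusP ω ↔ IsBounded (Set.range fun n : ℕ => bwdP ω n z) := Iff.rfl
  rw [mem_preimage, h1, mem_KK, isBounded_iff_forall_norm_le]
  simp only [Set.forall_mem_range, Homeomorph.coe_prodComm, this]
  have hs : ∀ z : ℂ × ℂ, ‖z.swap‖ = ‖z‖ := fun z => max_comm _ _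
  simp only [hs]

/-- lower semicontinuity of `ω ↦ J_{γ(ω)}± = ∂K_{γ(ω)}±` on `P^ℤ`. -/
theorem stmt_18 (N : Finset ℕ) (hN : ∀ n ∈ N, 2 ≤ n)
    (P : Set (Param N)) (hPne : P.Nonempty) (hPc : IsCompact P)
    (hP : ∀ q ∈ P, q.2.2.1 ≠ 0 ∧ q.2.2.2 0 ≠ 0) :
    (∀ (ω : ℤ → ↥P) (z₀ : ℂ × ℂ), z₀ ∈ frontier (KPlusP ω) →
      ∀ ωs : ℕ → (ℤ → ↥P), Filter.Tendsto ωs Filter.atTop (nhds ω) →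
        ∃ zs : ℕ → ℂ × ℂ, (∀ k : ℕ, zs k ∈ frontier (KPlusP (ωs k))) ∧
          Filter.Tendsto zs Filter.atTop (nhds z₀)) ∧
    (∀ (ω : ℤ → ↥P) (z₀ : ℂ × ℂ), z₀ ∈ frontier (KMinusP ω) →
      ∀ ωs : ℕ → (ℤ → ↥P), Filter.Tendsto ωs Filter.atTop (nhds ω) →
        ∃ zs : ℕ → ℂ × ℂ, (∀ k : ℕ, zs k ∈ frontier (KMinusP (ωs k))) ∧
          Filter.Tendsto zs Filter.atTop (nhds z₀)) := by
  refine ⟨?_, ?_⟩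
  · intro ω z₀ hz₀ ωs hωs
    obtain ⟨c, R, C, A, H⟩ := fwd_HSys N hN P hPc hP
    simp only [KPlus_eq] at hz₀ ⊢
    refine H.lsc _ hz₀ (fun k n => ωs k (n : ℤ)) ?_
    rw [tendsto_pi_nhds] at hωs ⊢
    exact fun n => hωs _
  · intro ω z₀ hz₀ ωs hωs
    obtain ⟨c, R, C, A, H⟩ := bwd_HSys N hN P hPc hP
    simp only [KMinus_eq, ← Homeomorph.preimage_frontier] at hz₀ ⊢
    obtain ⟨zs, h1, h2⟩ := H.lsc _ hz₀ (fun k (n : ℕ) => ωs k (-((n : ℤ) + 1))) (by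
      rw [tendsto_pi_nhds] at hωs ⊢
      exact fun n => hωs _)
    refine ⟨fun k => (zs k).swap, fun k => ?_, ?_⟩
    · simpa using h1 k
    · have := (continuous_swap.tendsto _).comp h2
      simpa [Function.comp_def] using this
end
end
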